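/- arXiv:2207.09359 — 2 statements merged into one kernel-verified Lean document; each statement's English description precedes it below -/
import Mathlib

section
/- Let R be a commutative ring, let 1 ≤ k ≤ n, and let (p_{i_1,…,i_k}) be a specialization of A_{k,n} with values in R. Let λ_{i_2,…,i_k} ∈ R be arbitrary elements indexed by tuples 1 < i_2 < … < i_k ≤ n, and for j = 1,…,n set a_j := ∑_{1 < i_2 < … < i_k ≤ n} λ_{i_2,…,i_k} · p_{j,i_2,…,i_k}, and set δ := a_1. Then for all j_1,…,j_k ∈ {1,…,n}: δ · p_{j_1,…,j_k} = ∑_{ν=1}^{k} (−1)^{ν−1} · a_{j_ν} · p_{1,j_1,…,ĵ_ν,…,j_k}, where ĵ_ν means the index j_ν is omitted. -/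
/-- The tuple `(i₁, …, i_{k-1}, x)` used in the first factor of the Plücker relation. -/
def pluTuple {n k : ℕ} (i : Fin (k - 1) → Fin n) (x : Fin n) : Fin k → Fin n :=
  fun s => if h : (s : ℕ) < k - 1 then i ⟨s, h⟩ else x

/-- A specialization of the coordinate ring `A_{k,n}` of the Grassmannian `Gr(k,n)`. -/
def IsSpecialization {R : Type*} [CommRing R] (k n : ℕ) (p : (Fin k → Fin n) → R) : Prop :=
  (∀ (f : Fin k → Fin n) (σ : Equiv.Perm (Fin k)),
      p (f ∘ σ) = (Equiv.Perm.sign σ : ℤ) • p f) ∧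
  (∀ f : Fin k → Fin n, ¬ Function.Injective f → p f = 0) ∧
  (∀ (i : Fin (k - 1) → Fin n) (j : Fin (k + 1) → Fin n),
      ∑ r : Fin (k + 1), (-1 : R) ^ (r : ℕ) *
        p (pluTuple i (j r)) * p (j ∘ r.succAbove) = 0)

/-- The `k`-tuple `(x, g₁, …, g_{k-1})` obtained by prepending the index `x` to the
`(k-1)`-tuple `g`. -/
def consTuple {n k : ℕ} (x : Fin n) (g : Fin (k - 1) → Fin n) : Fin k → Fin n :=
  fun s => if h : (s : ℕ) = 0 then x else g ⟨(s : ℕ) - 1, by have := s.2; omega⟩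

lemma plu_eq_cons {n m : ℕ} (x : Fin n) (g : Fin m → Fin n) :
    (pluTuple (k := m + 1) g x) = (consTuple (k := m + 1) x g) ∘ finRotate (m + 1) := by
  funext s
  refine Fin.lastCases ?_ (fun t => ?_) s
  · simp [pluTuple, consTuple]
  · have : ((finRotate (m + 1) t.castSucc : Fin (m + 1)) : ℕ) = t + 1 :=
      coe_finRotate_of_ne_last (Fin.castSucc_lt_last t).ne
    simp [pluTuple, consTuple, this]

lemma cons_succAbove {n m : ℕ} (x : Fin n) (j : Fin (m + 1) → Fin n) (v : Fin (m + 1)) :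
    (Fin.cons x j : Fin (m + 2) → Fin n) ∘ v.succ.succAbove =
      consTuple (k := m + 1) x (j ∘ v.succAbove) := by
  funext s
  refine Fin.cases ?_ (fun t => ?_) s
  · simp [consTuple]
  · simp [consTuple]

lemma plucker_exchange {R : Type*} [CommRing R] {m n : ℕ}
    (p : (Fin (m + 1) → Fin n) → R) (hspec : IsSpecialization (m + 1) n p)
    (x : Fin n) (g : Fin m → Fin n) (j : Fin (m + 1) → Fin n) :
    p (consTuple (k := m + 1) x g) * p j = ∑ v : Fin (m + 1), (-1 : R) ^ (v : ℕ) *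
      p (consTuple (k := m + 1) (j v) g) *
      p (consTuple (k := m + 1) x (j ∘ v.succAbove)) := by
  obtain ⟨h1, -, h3⟩ := hspec
  have hp : ∀ y : Fin n, p (pluTuple (k := m + 1) g y) =
      (-1 : R) ^ m * p (consTuple (k := m + 1) y g) := by
    intro y
    rw [plu_eq_cons, h1, sign_finRotate]
    simp
  have h := h3 g (Fin.cons x j)
  rw [Fin.sum_univ_succ] at h
  simp only [Fin.cons_zero, Fin.cons_succ, cons_succAbove, hp, Fin.val_succ] at h
  have h0 : (Fin.cons x j : Fin (m + 2) → Fin n) ∘ (0 : Fin (m + 2)).succAbove = j := by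
    funext s; simp
  rw [h0] at h
  have hs : (-1 : R) ^ m * (-1 : R) ^ m = 1 := by
    rw [← mul_pow]; simp
  have h2 := congrArg (fun z => (-1 : R) ^ m * z) h
  simp only [mul_add, mul_zero, Finset.mul_sum] at h2
  rw [← sub_eq_zero, ← h2, sub_eq_add_neg, ← Finset.sum_neg_distrib]
  congr 1
  · simp only [Fin.val_zero, pow_zero]
    linear_combination (-p (consTuple (k := m + 1) x g) * p j) * hs
  · refine Finset.sum_congr rfl fun v _ => ?_
    rw [pow_succ]
    linear_combination ((-1 : R) ^ (v : ℕ) * p (consTuple (k := m + 1) (j v) g) *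
      p (consTuple (k := m + 1) x (j ∘ v.succAbove))) * hs

open Classical in
/-- Equation `eq:ai`: let `p` be a specialization of `A_{k,n}` over a
commutative ring `R`, let `λ` be arbitrary elements indexed by tuples
`1 < i₂ < … < i_k ≤ n`, set `a_j := ∑ λ_{i₂,…,i_k} · p_{j,i₂,…,i_k}` and `δ := a₁`.
Then `δ · p_{j₁,…,j_k} = ∑_{ν=1}^{k} (−1)^{ν−1} a_{j_ν} · p_{1,j₁,…,ĵ_ν,…,j_k}` for all
`j₁,…,j_k ∈ {1,…,n}`. -/
theorem stmt11 {R : Type*} [CommRing R] (k n : ℕ) (hk : 1 ≤ k) (hkn : k ≤ n)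
    (p : (Fin k → Fin n) → R) (hspec : IsSpecialization k n p)
    (lam : (Fin (k - 1) → Fin n) → R)
    (a : Fin n → R)
    (ha : ∀ j : Fin n, a j = ∑ g : Fin (k - 1) → Fin n,
      if StrictMono g ∧ (∀ t, (g t : ℕ) ≠ 0) then lam g * p (consTuple j g) else 0)
    (δ : R) (hδ : δ = a ⟨0, lt_of_lt_of_le hk hkn⟩)
    (j : Fin k → Fin n) :
    δ * p j = ∑ ν : Fin k, (-1 : R) ^ (ν : ℕ) * a (j ν) *
      p (consTuple ⟨0, lt_of_lt_of_le hk hkn⟩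
        (j ∘ Fin.cast (Nat.succ_pred_eq_of_pos hk) ∘
          (Fin.cast (Nat.succ_pred_eq_of_pos hk).symm ν).succAbove)) := by
  obtain ⟨m, rfl⟩ : ∃ m, k = m + 1 := ⟨k - 1, by omega⟩
  subst hδ
  have key := plucker_exchange p hspec
  rw [ha, Finset.sum_mul]
  simp only [ha, Finset.mul_sum, Finset.sum_mul]
  rw [Finset.sum_comm]
  refine Finset.sum_congr rfl fun g _ => ?_
  split_ifs with hg
  · rw [mul_assoc]
    refine (congrArg (lam g * ·) (key _ g j)).trans ?_
    simp only [Finset.mul_sum]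
    refine Finset.sum_congr rfl fun v _ => ?_
    change lam g * (_ * _ * p (consTuple _ (j ∘ v.succAbove))) =
      _ * (lam g * _) * p (consTuple _ (j ∘ v.succAbove))
    ring
  · simp
end

section
/- Let K be a field, let 2 ≤ k ≤ n, let (p_{i_1,…,i_k}) be a specialization of A_{k,n} with values in K, and let δ ∈ K be nonzero. Define q_{i_1,…,i_{k−1}} := p_{1, i_1+1, …, i_{k−1}+1} / δ for all tuples (i_1,…,i_{k−1}) of indices from {1,…,n−1}. Then (q_{i_1,…,i_{k−1}}) is a specialization of A_{k−1,n−1}, i.e. it is alternating in its indices and satisfies the Plücker relations for parameters (k−1, n−1). -/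
theorem stmt12_aux {K : Type*} [Field K] (m N : ℕ)
    (p : (Fin (m + 2) → Fin (N + 1)) → K) (hspec : IsSpecialization (m + 2) (N + 1) p)
    (δ : K) (q : (Fin (m + 1) → Fin N) → K)
    (hq : ∀ g : Fin (m + 1) → Fin N,
      q g = p (Fin.cons (0 : Fin (N + 1)) (fun s => (g s).succ) : Fin (m + 2) → Fin (N + 1)) / δ) :
    IsSpecialization (m + 1) N q := by
  obtain ⟨h1, h2, h3⟩ := hspec
  refine ⟨?_, ?_, ?_⟩
  · intro f σ
    rw [hq, hq]
    have key : (Fin.cons (0 : Fin (N + 1)) (fun s => ((f ∘ σ) s).succ) : Fin (m + 2) → Fin (N + 1))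
        = (Fin.cons (0 : Fin (N + 1)) (fun s => (f s).succ) : Fin (m + 2) → Fin (N + 1)) ∘
          (Equiv.Perm.decomposeFin.symm (0, σ)) := by
      funext s
      refine Fin.cases ?_ (fun t => ?_) s
      · simp
      · simp
    rw [key, h1, Equiv.Perm.decomposeFin.symm_sign]
    simp [mul_div_assoc]
  · intro f hf
    rw [hq, h2, zero_div]
    intro hinj
    apply hf
    intro a b hab
    have : a.succ = b.succ := hinj (by simp [hab])
    exact Fin.succ_injective _ this
  · intro i j
    have h := h3 (Fin.cons (0 : Fin (N + 1)) (fun s : Fin m => (i s).succ) :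
        Fin (m + 1) → Fin (N + 1))
      (Fin.cons (0 : Fin (N + 1)) (fun s => (j s).succ) : Fin (m + 3) → Fin (N + 1))
    rw [Fin.sum_univ_succ] at h
    have hz : p (pluTuple (Fin.cons (0 : Fin (N + 1)) (fun s : Fin m => (i s).succ) :
        Fin (m + 1) → Fin (N + 1)) (0 : Fin (N + 1))) = 0 := by
      apply h2
      intro hinj
      have : (0 : Fin (m + 2)) = Fin.last (m + 1) := hinj (by
        simp [pluTuple])
      simp [Fin.ext_iff] at this
    rw [Fin.cons_zero, hz] at h
    have hs : ∀ r : Fin (m + 2), (-1 : K) ^ (r : ℕ) * q (pluTuple i (j r)) * q (j ∘ r.succAbove)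
        = (-(1 / δ ^ 2)) * ((-1 : K) ^ (r.succ : ℕ) *
          p (pluTuple (Fin.cons (0 : Fin (N + 1)) (fun s : Fin m => (i s).succ) :
            Fin (m + 1) → Fin (N + 1))
            ((Fin.cons (0 : Fin (N + 1)) (fun s => (j s).succ) :
              Fin (m + 3) → Fin (N + 1)) r.succ)) *
          p ((Fin.cons (0 : Fin (N + 1)) (fun s => (j s).succ) :
              Fin (m + 3) → Fin (N + 1)) ∘ r.succ.succAbove)) := by
      intro r
      have e1 : (Fin.cons (0 : Fin (N + 1)) (fun s => ((pluTuple i (j r) : Fin (m + 1) → Fin N) s).succ) :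
          Fin (m + 2) → Fin (N + 1)) =
          pluTuple (Fin.cons (0 : Fin (N + 1)) (fun s : Fin m => (i s).succ) :
            Fin (m + 1) → Fin (N + 1)) (j r).succ := by
        funext s
        refine Fin.cases ?_ (fun t => ?_) s
        · simp [pluTuple]
        · by_cases ht : (t : ℕ) < m
          · have ht2 : ((t.succ : Fin (m + 2)) : ℕ) < m + 2 - 1 := by
              rw [Fin.val_succ]; omega
            have ht1 : (t : ℕ) < m + 1 - 1 := ht
            rw [Fin.cons_succ]
            unfold pluTuple
            rw [dif_pos ht1, dif_pos ht2]
            rfl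
          · simp [pluTuple, ht]
      have e2 : (Fin.cons (0 : Fin (N + 1)) (fun s => ((j ∘ r.succAbove) s).succ) :
          Fin (m + 2) → Fin (N + 1)) =
          (Fin.cons (0 : Fin (N + 1)) (fun s => (j s).succ) :
              Fin (m + 3) → Fin (N + 1)) ∘ r.succ.succAbove := by
        funext s
        refine Fin.cases ?_ (fun t => ?_) s
        · simp
        · simp
      rw [hq, hq, e1, e2, Fin.cons_succ, Fin.val_succ, pow_succ]
      ring
    rw [Finset.sum_congr rfl (fun r _ => hs r), ← Finset.mul_sum]
    simp only [mul_zero, zero_mul, zero_add] at h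
    exact (congrArg _ h).trans (mul_zero _)

/-- Equation `eq:Xt`: let `K` be a field, `2 ≤ k ≤ n`, `p` a
specialization of `A_{k,n}` with values in `K`, and `δ ∈ K` nonzero. Then
`q_{i₁,…,i_{k−1}} := p_{1, i₁+1, …, i_{k−1}+1} / δ` defines a specialization of
`A_{k−1,n−1}`. -/
theorem stmt12 {K : Type*} [Field K] (k n : ℕ) (hk : 2 ≤ k) (hkn : k ≤ n)
    (p : (Fin k → Fin n) → K) (hspec : IsSpecialization k n p)
    (δ : K) (hδ : δ ≠ 0)
    (q : (Fin (k - 1) → Fin (n - 1)) → K)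
    (hq : ∀ g : Fin (k - 1) → Fin (n - 1), q g =
      p (fun s : Fin k =>
        if h : (s : ℕ) = 0 then ⟨0, by omega⟩
        else ⟨(g ⟨(s : ℕ) - 1, by have := s.2; omega⟩ : ℕ) + 1, by
          have := (g ⟨(s : ℕ) - 1, by have := s.2; omega⟩).2; omega⟩) / δ) :
    IsSpecialization (k - 1) (n - 1) q := by
  obtain ⟨m, rfl⟩ : ∃ m, k = m + 2 := ⟨k - 2, by omega⟩
  obtain ⟨N, rfl⟩ : ∃ N, n = N + 1 := ⟨n - 1, by omega⟩
  refine stmt12_aux m N p hspec δ q (fun g => ?_)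
  rw [hq]
  congr 2
  funext s
  refine Fin.cases ?_ (fun t => ?_) s
  · rfl
  · rfl
end
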